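/- arXiv:1501.03643 — 2 statements merged into one kernel-verified Lean document; each statement's English description precedes it below -/
import Mathlib

section
/- Let H be a finite-dimensional real inner product space, ‖·‖♯ a norm on H with dual norm ‖·‖♦, and Φ : H → ℝ^M linear. Let κ ∈ (0,1), λ > 0, x♮ ∈ H, and ω ∈ ℝ^M with ‖Φᵀω‖♦ ≤ κλ. If x* minimizes x ↦ (1/2)‖Φx − (Φx♮ + ω)‖₂² + λ‖x‖♯, then ‖x*‖♯ − κ‖x* − x♮‖♯ ≤ ‖x♮‖♯. -/
noncomputable section

open scoped RealInnerProductSpace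

variable {H : Type*} [NormedAddCommGroup H] [InnerProductSpace ℝ H] [FiniteDimensional ℝ H]

/-- `sharp` is a norm on `H`. -/
structure IsNormOn (sharp : H → ℝ) : Prop where
  triangle : ∀ x y : H, sharp (x + y) ≤ sharp x + sharp y
  smul_eq : ∀ (c : ℝ) (x : H), sharp (c • x) = |c| * sharp x
  eq_zero_of : ∀ x : H, sharp x = 0 → x = 0

/-- The dual norm of `sharp`: `‖u‖♦ = sup {|⟨u,v⟩| : ‖v‖♯ ≤ 1}`. -/
def dualNorm (sharp : H → ℝ) (u : H) : ℝ :=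
  sSup {r : ℝ | ∃ v : H, sharp v ≤ 1 ∧ r = |⟪u, v⟫|}

/-- The subdifferential of `f` at `x`. -/
def subdiff (f : H → ℝ) (x : H) : Set H :=
  {u : H | ∀ y : H, f y ≥ f x + ⟪u, y - x⟫}

/-- `(H, A, sharp)` is a compressed sensing space with bound `L`. -/
structure IsCSSpace (A : Set H) (sharp : H → ℝ) (L : ℝ) : Prop where
  zero_mem : (0 : H) ∈ A
  decomp : ∀ a ∈ A, ∀ v : H, ∃ z₁ z₂ : H, v = z₁ + z₂ ∧
    sharp (a + z₁) = sharp a + sharp z₁ ∧ sharp z₂ ≤ L * ‖v‖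

/-- `Φ` satisfies the `(ρ, α)`-robust width property over the unit `sharp`-ball. -/
def RobustWidth {M : ℕ} (Φ : H →ₗ[ℝ] EuclideanSpace ℝ (Fin M)) (sharp : H → ℝ)
    (ρ α : ℝ) : Prop :=
  ∀ x : H, ‖Φ x‖ < α * ‖x‖ → ‖x‖ ≤ ρ * sharp x

/-- A linear functional on a finite-dimensional space is bounded with respect to any norm. -/
theorem LinearMap.exists_abs_le_mul_of_norm_axioms {V : Type*} [AddCommGroup V] [Module ℝ V]
    [FiniteDimensional ℝ V] (p : V → ℝ) (triangle : ∀ x y, p (x + y) ≤ p x + p y)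
    (smul_eq : ∀ (c : ℝ) x, p (c • x) = |c| * p x) (nonneg : ∀ x, 0 ≤ p x)
    (eq_zero_of : ∀ x, p x = 0 → x = 0) (f : V →ₗ[ℝ] ℝ) :
    ∃ C : ℝ, 0 ≤ C ∧ ∀ x, |f x| ≤ C * p x := by
  let _ : Norm V := ⟨p⟩
  have core : NormedSpace.Core ℝ V :=
    { norm_nonneg := nonneg
      norm_smul := smul_eq
      norm_triangle := triangle
      norm_eq_zero_iff := fun x => ⟨eq_zero_of x, fun hx => by
        subst hx
        change p 0 = 0
        simpa using smul_eq 0 0⟩ }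
  let _ : NormedAddCommGroup V := NormedAddCommGroup.ofCore core
  let _ : NormedSpace ℝ V := NormedSpace.ofCore core
  exact ⟨‖f.toContinuousLinearMap‖, norm_nonneg _, f.toContinuousLinearMap.le_opNorm⟩

namespace IsNormOn

theorem nonneg {V : Type*} [NormedAddCommGroup V] [InnerProductSpace ℝ V] {sharp : V → ℝ}
    (hs : IsNormOn sharp) (x : V) : 0 ≤ sharp x := by
  have h0 := hs.smul_eq 0 0
  have hneg := hs.smul_eq (-1) x
  have h := hs.triangle x ((-1 : ℝ) • x)
  simp only [neg_smul, one_smul, add_neg_cancel, abs_neg, abs_one, one_mul] at hneg h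
  simp only [smul_zero, abs_zero, zero_mul] at h0
  linarith

theorem bddAbove_dualNorm {sharp : H → ℝ} (hs : IsNormOn sharp) (u : H) :
    BddAbove {r : ℝ | ∃ v : H, sharp v ≤ 1 ∧ r = |⟪u, v⟫|} := by
  obtain ⟨C, hC, hle⟩ := LinearMap.exists_abs_le_mul_of_norm_axioms sharp hs.triangle hs.smul_eq
    hs.nonneg hs.eq_zero_of (innerₗ H u)
  refine ⟨C, ?_⟩
  rintro _ ⟨v, hv, rfl⟩
  exact (hle v).trans (mul_le_of_le_one_right hC hv)

theorem abs_inner_le_dualNorm_mul {sharp : H → ℝ} (hs : IsNormOn sharp) (u v : H) :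
    |⟪u, v⟫| ≤ dualNorm sharp u * sharp v := by
  rcases (hs.nonneg v).eq_or_lt with hv | hv
  · rw [← hv, hs.eq_zero_of v hv.symm]
    simp
  · have h : |⟪u, (sharp v)⁻¹ • v⟫| ≤ dualNorm sharp u := by
      refine le_csSup (hs.bddAbove_dualNorm u) ⟨_, ?_, rfl⟩
      rw [hs.smul_eq, abs_of_pos (inv_pos.mpr hv), inv_mul_cancel₀ hv.ne']
    rwa [inner_smul_right, abs_mul, abs_of_pos (inv_pos.mpr hv), inv_mul_le_iff₀ hv,
      mul_comm] at h

end IsNormOn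

theorem lasso_step1 {M : ℕ} (sharp : H → ℝ) (hs : IsNormOn sharp)
    (Φ : H →ₗ[ℝ] EuclideanSpace ℝ (Fin M))
    (κ : ℝ) (hκ : κ ∈ Set.Ioo (0 : ℝ) 1)
    (lam : ℝ) (hlam : 0 < lam)
    (xnat : H) (ω : EuclideanSpace ℝ (Fin M))
    (hω : dualNorm sharp ((LinearMap.adjoint Φ) ω) ≤ κ * lam)
    (xstar : H)
    (hmin : ∀ x : H,
      (1 / 2) * ‖Φ xstar - (Φ xnat + ω)‖ ^ 2 + lam * sharp xstar ≤
        (1 / 2) * ‖Φ x - (Φ xnat + ω)‖ ^ 2 + lam * sharp x) :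
    sharp xstar - κ * sharp (xstar - xnat) ≤ sharp xnat := by
  have hdual : ⟪Φ (xstar - xnat), ω⟫ ≤ κ * lam * sharp (xstar - xnat) := by
    rw [← LinearMap.adjoint_inner_right, real_inner_comm]
    exact (le_abs_self _).trans <| (hs.abs_inner_le_dualNorm_mul _ _).trans <|
      mul_le_mul_of_nonneg_right hω (hs.nonneg _)
  have h := hmin xnat
  rw [← sub_sub, ← map_sub, norm_sub_sq_real, sub_add_cancel_left, norm_neg] at h
  refine le_of_mul_le_mul_left ?_ hlam
  linarith [sq_nonneg ‖Φ (xstar - xnat)‖]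
end
end

section
/- Let (H, A, ‖·‖♯) be a compressed sensing space with bound L, let Φ : H → ℝ^M be a nonzero linear map, set τ = sup{‖Φx‖₂ : ‖x‖♯ ≤ 1}, and fix constants C₀, C₁ > 0. Suppose that for every x♮ ∈ H, every λ > 0, and every ω ∈ ℝ^M with ‖Φᵀω‖♦ ≤ λ, any x* minimizing ‖x‖♯ subject to ‖Φᵀ(Φx − (Φx♮ + ω))‖♦ ≤ λ satisfies ‖x* − x♮‖₂ ≤ C₀‖x♮ − a‖♯ + C₁·λ for every a ∈ A. Then Φ satisfies the (ρ,α)-robust width property over the unit ♯-ball with ρ = 2C₀ and α = 1/(2τC₁). -/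
noncomputable section

open scoped RealInnerProductSpace

variable {H : Type*} [NormedAddCommGroup H] [InnerProductSpace ℝ H] [FiniteDimensional ℝ H]

theorem IsNormOn.map_zero {sharp : H → ℝ} (hs : IsNormOn sharp) : sharp 0 = 0 := by
  simpa using hs.smul_eq 0 0

theorem IsNormOn.nonneg_s11 {sharp : H → ℝ} (hs : IsNormOn sharp) (x : H) : 0 ≤ sharp x := by
  have h₁ := hs.triangle x ((-1 : ℝ) • x)
  have h₂ := hs.smul_eq (-1) x
  simp only [neg_smul, one_smul, add_neg_cancel, abs_neg, abs_one, one_mul, hs.map_zero] at h₁ h₂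
  linarith

theorem dualNorm_le {sharp : H → ℝ} {u : H} {c : ℝ} (hc : 0 ≤ c)
    (h : ∀ v : H, sharp v ≤ 1 → |⟪u, v⟫| ≤ c) : dualNorm sharp u ≤ c :=
  Real.sSup_le (by rintro _ ⟨v, hv, rfl⟩; exact h v hv) hc

theorem dualNorm_adjoint_le {M : ℕ} {sharp : H → ℝ} {Φ : H →ₗ[ℝ] EuclideanSpace ℝ (Fin M)}
    {τ : ℝ} (hτ₀ : 0 ≤ τ) (hτ : ∀ v : H, sharp v ≤ 1 → ‖Φ v‖ ≤ τ)
    (y : EuclideanSpace ℝ (Fin M)) : dualNorm sharp (LinearMap.adjoint Φ y) ≤ ‖y‖ * τ :=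
  dualNorm_le (by positivity) fun v hv => by
    rw [LinearMap.adjoint_inner_left]
    exact (abs_real_inner_le_norm _ _).trans (by gcongr; exact hτ v hv)

theorem robustWidth_of_dantzig {M : ℕ} (sharp : H → ℝ) (hs : IsNormOn sharp)
    (A : Set H) (L : ℝ) (hcs : IsCSSpace A sharp L)
    (Φ : H →ₗ[ℝ] EuclideanSpace ℝ (Fin M)) (hΦ : Φ ≠ 0)
    (τ : ℝ) (hτ : τ = sSup {r : ℝ | ∃ x : H, sharp x ≤ 1 ∧ r = ‖Φ x‖})
    (C₀ C₁ : ℝ) (hC₀ : 0 < C₀) (hC₁ : 0 < C₁)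
    (hb : ∀ xnat : H, ∀ lam : ℝ, 0 < lam → ∀ ω : EuclideanSpace ℝ (Fin M),
      dualNorm sharp ((LinearMap.adjoint Φ) ω) ≤ lam →
      ∀ xstar : H,
        dualNorm sharp ((LinearMap.adjoint Φ) (Φ xstar - (Φ xnat + ω))) ≤ lam →
        (∀ x : H,
          dualNorm sharp ((LinearMap.adjoint Φ) (Φ x - (Φ xnat + ω))) ≤ lam →
            sharp xstar ≤ sharp x) →
        ∀ a ∈ A, ‖xstar - xnat‖ ≤ C₀ * sharp (xnat - a) + C₁ * lam) :
    RobustWidth Φ sharp (2 * C₀) (1 / (2 * τ * C₁)) := by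
  intro x hx
  have hτ₀ : 0 ≤ τ := hτ ▸ Real.sSup_nonneg (by rintro _ ⟨v, -, rfl⟩; exact norm_nonneg _)
  have hτ_ne : τ ≠ 0 := by
    rintro rfl
    simp only [mul_zero, zero_mul, div_zero] at hx
    exact (norm_nonneg _).not_gt hx
  have hτ_pos : 0 < τ := hτ₀.lt_of_ne' hτ_ne
  have hbdd : BddAbove {r : ℝ | ∃ v : H, sharp v ≤ 1 ∧ r = ‖Φ v‖} := by
    by_contra h
    exact hτ_ne (hτ.trans (Real.sSup_of_not_bddAbove h))
  have hΦτ (v : H) (hv : sharp v ≤ 1) : ‖Φ v‖ ≤ τ := hτ ▸ le_csSup hbdd ⟨v, hv, rfl⟩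
  have hx_pos : 0 < ‖x‖ := by
    rw [norm_pos_iff]
    rintro rfl
    simp at hx
  have hlam : ‖Φ x‖ * τ ≤ ‖x‖ / (2 * C₁) := by
    calc ‖Φ x‖ * τ ≤ 1 / (2 * τ * C₁) * ‖x‖ * τ := by gcongr
      _ = ‖x‖ / (2 * C₁) := by field_simp
  have hlam_pos : 0 < ‖x‖ / (2 * C₁) := by positivity
  have key := hb x (‖x‖ / (2 * C₁)) hlam_pos 0
    (dualNorm_le hlam_pos.le fun v _ => by simpa using hlam_pos.le) 0
    ((dualNorm_adjoint_le hτ₀ hΦτ _).trans (by simpa using hlam))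
    (fun y _ => hs.map_zero.trans_le (hs.nonneg_s11 y)) 0 hcs.zero_mem
  have hhalf : C₁ * (‖x‖ / (2 * C₁)) = ‖x‖ / 2 := by field_simp
  rw [hhalf, zero_sub, norm_neg, sub_zero] at key
  linarith
end
end
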